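/- For k ∈ {1,2,3}, let Γ′ be a G_k-prebrick and Γ := φ_k⁻¹(Γ′). Then the injective group homomorphism ψ_k : M → ℤ³ (where ψ₁(n) = (d(n)/r, n₂, n₃), ψ₂(n) = (n₁, d(n)/r, n₃), ψ₃(n) = (n₁, n₂, d(n)/r) for n ∈ M, i.e. r ∣ d(n)) maps S(Γ) bijectively onto S(Γ′), where S(Γ′) is formed with respect to the G_k-prebrick structure of Γ′. In particular, if Γ′ is a G_k-brick then Γ is a G-brick. -/

import Mathlib

noncomputable section

open Classical

/-- The lattice `ℤ³` of exponents of Laurent monomials in `x, y, z` (written additively). -/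
abbrev V3 : Type := Fin 3 → ℤ

/-- The standard basis vectors `e₁, e₂, e₃` (indices `0, 1, 2`). -/
def ee (i : Fin 3) : V3 := Pi.single i 1

/-- `n` is a genuine monomial, i.e. `n ∈ ℕ³ ⊆ ℤ³`. -/
def IsNat3 (n : V3) : Prop := ∀ i, 0 ≤ n i

/-- The weight map `w(m) = β₁m₁ + β₂m₂ + β₃m₃ (mod s)`. -/
def wmap (s : ℕ) (β : Fin 3 → ℤ) (m : V3) : ZMod s := ((∑ i, β i * m i : ℤ) : ZMod s)

/-- One step of a (fractional) monomial path inside `Γ`: multiply or divide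
by one of `x, y, z`, staying in `Γ`. -/
def StepRel (Γ : Set V3) (m m' : V3) : Prop :=
  m' ∈ Γ ∧ ∃ i : Fin 3, m' = m + ee i ∨ m' = m - ee i

/-- A prebrick with respect to the modulus `s` and the weights `β`. -/
structure IsPrebrick (s : ℕ) (β : Fin 3 → ℤ) (Γ : Set V3) : Prop where
  zero_mem : (0 : V3) ∈ Γ
  bijOn : Set.BijOn (wmap s β) Γ Set.univ
  saturated : ∀ m ∈ Γ, ∀ n n' : V3, IsNat3 n → IsNat3 n' → n' + n + m ∈ Γ → n + m ∈ Γ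
  connected : ∀ m ∈ Γ, Relation.ReflTransGen (StepRel Γ) m 0

/-- `wtG s β Γ m` is the unique element of `Γ` with the same weight as `m`
(when `Γ` is a prebrick). -/
noncomputable def wtG (s : ℕ) (β : Fin 3 → ℤ) (Γ : Set V3) (m : V3) : V3 :=
  Classical.epsilon fun g => g ∈ Γ ∧ wmap s β g = wmap s β m

/-- The monoid `S(Γ)`, generated by all `n + m − wt_Γ(n + m)`, `n ∈ ℕ³`, `m ∈ Γ`. -/
def SG (s : ℕ) (β : Fin 3 → ℤ) (Γ : Set V3) : AddSubmonoid V3 :=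
  AddSubmonoid.closure
    {v | ∃ n m : V3, IsNat3 n ∧ m ∈ Γ ∧ v = n + m - wtG s β Γ (n + m)}

/-- A brick: a prebrick with `S(Γ) ∩ (−S(Γ)) = {0}`. -/
def IsBrick (s : ℕ) (β : Fin 3 → ℤ) (Γ : Set V3) : Prop :=
  IsPrebrick s β Γ ∧ ∀ v ∈ SG s β Γ, -v ∈ SG s β Γ → v = 0

/-- `d(m) = m₁ + a·m₂ + (r−a)·m₃`. -/
def dd (r a : ℕ) (m : V3) : ℤ := m 0 + (a : ℤ) * m 1 + ((r : ℤ) - (a : ℤ)) * m 2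

/-- The round down functions of the weighted blowup with weight `(1, a, r−a)`:
`phiRD r a 0 = φ₁` (central), `phiRD r a 1 = φ₂` (left), `phiRD r a 2 = φ₃` (right);
the `k`-th coordinate is replaced by `⌊d(m)/r⌋`. -/
def phiRD (r a : ℕ) (k : Fin 3) (m : V3) : V3 :=
  Function.update m k ((dd r a m).fdiv (r : ℤ))

/-- Weights `(1, a, r−a)` of the group `G` of type `(1/r)(1, a, r−a)`. -/
def wtsG (r a : ℕ) : Fin 3 → ℤ := ![1, (a : ℤ), (r : ℤ) - (a : ℤ)]

/-- Moduli of the groups `G₁` (trivial), `G₂` of type `(1/a)(1,−r,r)` and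
`G₃` of type `(1/(r−a))(1,r,−r)`. -/
def gkMod (r a : ℕ) : Fin 3 → ℕ := ![1, a, r - a]

/-- Weights of the groups `G₁, G₂, G₃`. -/
def gkWts (r a : ℕ) : Fin 3 → Fin 3 → ℤ :=
  ![![0, 0, 0], ![1, -(r : ℤ), (r : ℤ)], ![1, (r : ℤ), -(r : ℤ)]]

theorem ee_nonneg (i : Fin 3) : 0 ≤ ee i :=
  Pi.single_nonneg.2 zero_le_one

theorem wtsG_pos {r a : ℕ} (h1 : 0 < a) (h2 : a < r) (k : Fin 3) : 0 < wtsG r a k := by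
  fin_cases k <;> simp [wtsG] <;> omega

theorem wtsG_le {r a : ℕ} (h1 : 0 < a) (h2 : a < r) (k : Fin 3) : wtsG r a k ≤ r := by
  fin_cases k <;> simp [wtsG] <;> omega

theorem wtsG_add_le {r a : ℕ} (h1 : 0 < a) (h2 : a < r) {i k : Fin 3} (hik : i ≠ k) :
    wtsG r a i + wtsG r a k ≤ r := by
  fin_cases i <;> fin_cases k <;> simp [wtsG] at hik ⊢ <;> omega

theorem gkMod_cast {r a : ℕ} (h2 : a < r) (k : Fin 3) : (gkMod r a k : ℤ) = wtsG r a k := by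
  fin_cases k <;> simp [wtsG, gkMod] <;> omega

theorem dd_add (r a : ℕ) (m n : V3) : dd r a (m + n) = dd r a m + dd r a n := by
  simp only [dd, Pi.add_apply]; ring

theorem dd_neg (r a : ℕ) (m : V3) : dd r a (-m) = -dd r a m := by
  simp only [dd, Pi.neg_apply]; ring

theorem dd_zero (r a : ℕ) : dd r a 0 = 0 := by simp [dd]

theorem dd_ee (r a : ℕ) (i : Fin 3) : dd r a (ee i) = wtsG r a i := by
  fin_cases i <;> simp [dd, ee, wtsG]

theorem dd_nonneg {r a : ℕ} (h2 : a < r) {n : V3} (hn : 0 ≤ n) : 0 ≤ dd r a n := by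
  have hc : (0 : ℤ) ≤ (r : ℤ) - a := by omega
  have h0 := hn 0
  have := mul_nonneg (Int.natCast_nonneg a) (hn 1)
  have := mul_nonneg hc (hn 2)
  simp only [dd, Pi.zero_apply] at *
  linarith

theorem dd_update (r a : ℕ) (k : Fin 3) (m : V3) (x : ℤ) :
    dd r a (Function.update m k x) = dd r a m + wtsG r a k * (x - m k) := by
  fin_cases k <;> (simp [dd, wtsG]; ring)

theorem wmap_wtsG (r a : ℕ) (m : V3) : wmap r (wtsG r a) m = (dd r a m : ZMod r) := by
  simp [wmap, dd, wtsG, Fin.sum_univ_three]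

theorem wmap_wtsG_eq_iff (r a : ℕ) (m n : V3) :
    wmap r (wtsG r a) m = wmap r (wtsG r a) n ↔ dd r a m % r = dd r a n % r := by
  rw [wmap_wtsG, wmap_wtsG, ZMod.intCast_eq_intCast_iff']

theorem phiRD_eq (r a : ℕ) (k : Fin 3) (m : V3) :
    phiRD r a k m = Function.update m k (dd r a m / r) := by
  rw [phiRD, Int.fdiv_eq_ediv_of_nonneg _ (Int.natCast_nonneg r)]

theorem phiRD_zero (r a : ℕ) (k : Fin 3) : phiRD r a k 0 = 0 := by
  simp [phiRD_eq, dd_zero]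

/-- Round down is monotone. -/
theorem phiRD_le_phiRD_add {r a : ℕ} (h2 : a < r) (k : Fin 3) (m : V3) {n : V3} (hn : 0 ≤ n) :
    phiRD r a k m ≤ phiRD r a k (m + n) := by
  rw [phiRD_eq, phiRD_eq, update_le_update_iff]
  refine ⟨Int.ediv_le_ediv (by omega) ?_, fun i _ => by simpa using hn i⟩
  linarith [dd_add r a m n, dd_nonneg h2 hn]

/-- Round down is equivariant under the invariant lattice. -/
theorem phiRD_add_of_dvd {r a : ℕ} (k : Fin 3) (m : V3) {v : V3} (hv : (r : ℤ) ∣ dd r a v) :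
    phiRD r a k (m + v) = phiRD r a k m + phiRD r a k v := by
  rw [phiRD_eq, phiRD_eq, phiRD_eq, dd_add, Int.add_ediv_of_dvd_right hv]
  ext i
  by_cases h : i = k
  · subst h; simp
  · simp [h]

/-- A Laurent monomial is determined by its round down and its weight. -/
theorem eq_of_phiRD_eq {r a : ℕ} (h1 : 0 < a) (h2 : a < r) {k : Fin 3} {m n : V3}
    (h : phiRD r a k m = phiRD r a k n) (hd : dd r a m % r = dd r a n % r) : m = n := by
  rw [phiRD_eq, phiRD_eq] at h
  have hk : dd r a m / r = dd r a n / r := by simpa using congrFun h k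
  have hdd : dd r a m = dd r a n := by
    rw [← Int.mul_ediv_add_emod (dd r a m) r, ← Int.mul_ediv_add_emod (dd r a n) r, hk, hd]
  have hup : n = Function.update m k (n k) := by
    ext i
    by_cases hi : i = k
    · subst hi; simp
    · simpa [hi] using (congrFun h i).symm
  have := dd_update r a k m (n k)
  rw [← hup, hdd] at this
  have h0 : n k - m k = 0 :=
    (mul_eq_zero.1 (by linarith : wtsG r a k * (n k - m k) = 0)).resolve_left
      (wtsG_pos h1 h2 k).ne'
  rw [hup, show n k = m k by linarith, Function.update_eq_self]

theorem wtsG_dvd_gkWts_sub (r a : ℕ) (k : Fin 3) (m : V3) :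
    wtsG r a k ∣ (dd r a m - (r + wtsG r a k) * m k) - ∑ i, gkWts r a k i * m i := by
  rw [Fin.sum_univ_three]
  fin_cases k
  · simp [wtsG]
  · exact ⟨-m 2, by simp [dd, wtsG, gkWts]; ring⟩
  · exact ⟨-m 1, by simp [dd, wtsG, gkWts]; ring⟩

theorem wtsG_dvd_emod_sub (r a : ℕ) (k : Fin 3) (m : V3) :
    wtsG r a k ∣ dd r a m % r - ∑ i, gkWts r a k i * phiRD r a k m i := by
  have h := wtsG_dvd_gkWts_sub r a k (phiRD r a k m)
  have e := Int.mul_ediv_add_emod (dd r a m) r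
  have e1 : dd r a (phiRD r a k m) = dd r a m + wtsG r a k * (dd r a m / r - m k) := by
    rw [phiRD_eq, dd_update]
  have e2 : phiRD r a k m k = dd r a m / r := by rw [phiRD_eq]; simp
  rw [e1, e2] at h
  have hsum := dvd_add h (Dvd.intro (m k) rfl)
  rwa [show dd r a m % r = dd r a m - r * (dd r a m / r) by linarith,
    show dd r a m - r * (dd r a m / r) - ∑ i, gkWts r a k i * phiRD r a k m i =
      dd r a m + wtsG r a k * (dd r a m / r - m k) - (r + wtsG r a k) * (dd r a m / r) -
        ∑ i, gkWts r a k i * phiRD r a k m i + wtsG r a k * m k by ring]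

/-- The `G_k`-weight of the round down of `m` is the reduction of the `G`-weight of `m`. -/
theorem wmap_phiRD {r a : ℕ} (h2 : a < r) (k : Fin 3) (m : V3) :
    wmap (gkMod r a k) (gkWts r a k) (phiRD r a k m) =
      ((dd r a m % r : ℤ) : ZMod (gkMod r a k)) := by
  rw [wmap, ZMod.intCast_eq_intCast_iff_dvd_sub, gkMod_cast h2]
  exact wtsG_dvd_emod_sub r a k m

theorem exists_phiRD_eq {r a : ℕ} {k : Fin 3} {p : V3} {t : ℤ} (h0 : 0 ≤ t)
    (htr : t < r) (ht : wtsG r a k ∣ t - ∑ i, gkWts r a k i * p i) :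
    ∃ m, phiRD r a k m = p ∧ dd r a m = r * p k + t := by
  obtain ⟨x, hx⟩ := ht
  obtain ⟨y, hy⟩ := wtsG_dvd_gkWts_sub r a k p
  have hd : dd r a (Function.update p k (x - y)) = r * p k + t := by
    rw [dd_update]; linear_combination hy - hx
  refine ⟨Function.update p k (x - y), ?_, hd⟩
  rw [phiRD_eq, hd, Function.update_idem, Int.add_ediv_of_dvd_left (Dvd.intro _ rfl),
    Int.mul_ediv_cancel_left _ (by omega), Int.ediv_eq_zero_of_lt h0 htr, add_zero,
    Function.update_eq_self]

theorem exists_phiRD_eq_of_window {r a : ℕ} (h1 : 0 < a) (h2 : a < r) (k : Fin 3) (p : V3) {l : ℤ}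
    (h0 : 0 ≤ l) (hl : l + wtsG r a k ≤ r) :
    ∃ m t, phiRD r a k m = p ∧ dd r a m = r * p k + t ∧ l ≤ t ∧ t < l + wtsG r a k := by
  set W := ∑ i, gkWts r a k i * p i with hW
  have hc := wtsG_pos h1 h2 k
  have hn := Int.emod_nonneg (W - l) hc.ne'
  have hlt := Int.emod_lt_of_pos (W - l) hc
  obtain ⟨m, hm, hd⟩ := exists_phiRD_eq (k := k) (p := p) (t := l + (W - l) % wtsG r a k)
    (by linarith) (by linarith)
    ⟨-((W - l) / wtsG r a k), by
      rw [← hW]; linear_combination Int.mul_ediv_add_emod (W - l) (wtsG r a k)⟩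
  exact ⟨m, _, hm, hd, by linarith, by linarith⟩

/-- Every elementary step `p ↦ p + eᵢ` lifts along the round down. -/
theorem exists_phiRD_add_ee {r a : ℕ} (h1 : 0 < a) (h2 : a < r) (k : Fin 3) (p : V3) (i : Fin 3) :
    ∃ m, phiRD r a k m = p ∧ phiRD r a k (m + ee i) = p + ee i := by
  have hr : (0 : ℤ) < r := by omega
  have hc := wtsG_pos h1 h2 k
  by_cases hik : i = k
  · subst hik
    obtain ⟨m, t, hm, hd, hl, hu⟩ := exists_phiRD_eq_of_window h1 h2 i p (l := r - wtsG r a i)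
      (by linarith [wtsG_le h1 h2 i]) (by linarith)
    refine ⟨m, hm, ?_⟩
    have hq : (r * p i + t + wtsG r a i) / r = p i + 1 := by
      rw [Int.ediv_eq_iff_of_pos hr]
      constructor <;> linarith [wtsG_le h1 h2 i]
    rw [phiRD_eq] at hm
    rw [phiRD_eq, dd_add, dd_ee, hd, hq]
    ext j
    by_cases hj : j = i
    · subst hj; simp [ee]
    · simpa [hj, ee] using congrFun hm j
  · obtain ⟨m, t, hm, hd, hl, hu⟩ := exists_phiRD_eq_of_window h1 h2 k p (l := 0) le_rfl
      (by linarith [wtsG_le h1 h2 k])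
    refine ⟨m, hm, ?_⟩
    have hci := wtsG_pos h1 h2 i
    have hq : (r * p k + t + wtsG r a i) / r = p k := by
      rw [Int.ediv_eq_iff_of_pos hr]
      constructor <;> linarith [wtsG_add_le h1 h2 hik]
    rw [phiRD_eq] at hm
    rw [phiRD_eq, dd_add, dd_ee, hd, hq]
    ext j
    by_cases hj : j = k
    · subst hj; simp [ee, Ne.symm hik]
    · simpa [hj] using congrFun hm j

/-- The symmetric version of `StepRel`: both ends of the step lie in `Γ`. -/
def Linked (Γ : Set V3) (m m' : V3) : Prop := m ∈ Γ ∧ StepRel Γ m m'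

theorem Linked.symm {Γ : Set V3} {m m' : V3} (h : Linked Γ m m') : Linked Γ m' m := by
  obtain ⟨hm, hm', i, rfl | rfl⟩ := h
  · exact ⟨hm', hm, i, Or.inr (by simp)⟩
  · exact ⟨hm', hm, i, Or.inl (by simp)⟩

theorem reflTransGen_linked_symm {Γ : Set V3} {m m' : V3}
    (h : Relation.ReflTransGen (Linked Γ) m m') : Relation.ReflTransGen (Linked Γ) m' m :=
  have : Std.Symm (Linked Γ) := ⟨fun _ _ => Linked.symm⟩
  Std.Symm.symm _ _ h

theorem reflTransGen_linked_add_smul {r a : ℕ} (h2 : a < r) (k : Fin 3) {Γ' : Set V3} (j : ℕ) :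
    ∀ m, phiRD r a k m ∈ Γ' → phiRD r a k (m + j • ee k) = phiRD r a k m →
      Relation.ReflTransGen (Linked (phiRD r a k ⁻¹' Γ')) m (m + j • ee k) := by
  induction j with
  | zero => intro m _ _; simpa using Relation.ReflTransGen.refl
  | succ j ih =>
    intro m hm he
    have hsplit : m + (j + 1) • ee k = m + ee k + j • ee k := by rw [succ_nsmul]; abel
    rw [hsplit] at he ⊢
    have hstep : phiRD r a k (m + ee k) = phiRD r a k m :=
      le_antisymm ((phiRD_le_phiRD_add h2 k _ (nsmul_nonneg (ee_nonneg k) j)).trans_eq he)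
        (phiRD_le_phiRD_add h2 k m (ee_nonneg k))
    have hmem : phiRD r a k (m + ee k) ∈ Γ' := by rwa [hstep]
    exact .head ⟨hm, hmem, k, Or.inl rfl⟩ (ih _ hmem (he.trans hstep.symm))

/-- The fibres of the round down are connected. -/
theorem reflTransGen_linked_of_phiRD_eq {r a : ℕ} (h2 : a < r) {k : Fin 3} {Γ' : Set V3} {m n : V3}
    (hm : phiRD r a k m ∈ Γ') (h : phiRD r a k m = phiRD r a k n) :
    Relation.ReflTransGen (Linked (phiRD r a k ⁻¹' Γ')) m n := by
  wlog hle : m k ≤ n k generalizing m n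
  · exact reflTransGen_linked_symm (this (h ▸ hm) h.symm (le_of_not_ge hle))
  obtain ⟨j, hj⟩ := Int.eq_ofNat_of_zero_le (sub_nonneg.2 hle)
  have hn : n = m + j • ee k := by
    have h' := h
    rw [phiRD_eq, phiRD_eq] at h'
    ext i
    by_cases hi : i = k
    · subst hi; simp [ee]; linarith
    · simpa [hi, ee] using (congrFun h' i).symm
  rw [hn] at h ⊢
  exact reflTransGen_linked_add_smul h2 k j m hm h.symm

/-- Paths in `Γ'` lift to paths in the preimage of `Γ'` under the round down. -/
theorem reflTransGen_linked_lift {r a : ℕ} (h1 : 0 < a) (h2 : a < r) {k : Fin 3} {Γ' : Set V3}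
    {p q : V3} (h : Relation.ReflTransGen (StepRel Γ') p q) {n : V3} (hn : phiRD r a k n = q) :
    p ∈ Γ' → ∀ m, phiRD r a k m = p →
      Relation.ReflTransGen (Linked (phiRD r a k ⁻¹' Γ')) m n := by
  induction h using Relation.ReflTransGen.head_induction_on with
  | refl =>
    intro hp m hm
    exact reflTransGen_linked_of_phiRD_eq h2 (hm ▸ hp) (hm.trans hn.symm)
  | @head p p' hstep _ ih =>
    intro hp m hm
    obtain ⟨hp', i, hi | hi⟩ := hstep
    · obtain ⟨u, hu, hui⟩ := exists_phiRD_add_ee h1 h2 k p i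
      rw [← hi] at hui
      exact (reflTransGen_linked_of_phiRD_eq h2 (hm ▸ hp) (hm.trans hu.symm)).trans
        (.head ⟨by rwa [Set.mem_preimage, hu], by rwa [Set.mem_preimage, hui], i, Or.inl rfl⟩
          (ih hp' _ hui))
    · obtain ⟨u, hu, hui⟩ := exists_phiRD_add_ee h1 h2 k p' i
      rw [eq_sub_iff_add_eq.1 hi] at hui
      exact (reflTransGen_linked_of_phiRD_eq h2 (hm ▸ hp) (hm.trans hui.symm)).trans
        (.head ⟨by rwa [Set.mem_preimage, hui], by rwa [Set.mem_preimage, hu], i, Or.inr (by simp)⟩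
          (ih hp' _ hu))

/-- The preimage of a `G_k`-prebrick under the round down is a `G`-prebrick. -/
theorem IsPrebrick.preimage_phiRD {r a : ℕ} (h1 : 0 < a) (h2 : a < r) {k : Fin 3} {Γ' : Set V3}
    (h' : IsPrebrick (gkMod r a k) (gkWts r a k) Γ') :
    IsPrebrick r (wtsG r a) (phiRD r a k ⁻¹' Γ') where
  zero_mem := by rw [Set.mem_preimage, phiRD_zero]; exact h'.zero_mem
  bijOn := by
    refine ⟨fun _ _ => Set.mem_univ _, fun m hm n hn hw => ?_, fun x _ => ?_⟩
    · rw [wmap_wtsG_eq_iff] at hw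
      exact eq_of_phiRD_eq h1 h2
        (h'.bijOn.injOn hm hn (by rw [wmap_phiRD h2, wmap_phiRD h2, hw])) hw
    · have hr : (0 : ℤ) < r := by omega
      obtain ⟨z, rfl⟩ := ZMod.intCast_surjective x
      obtain ⟨p, hp, hw⟩ :=
        h'.bijOn.surjOn (Set.mem_univ ((z % r : ℤ) : ZMod (gkMod r a k)))
      rw [wmap, ZMod.intCast_eq_intCast_iff_dvd_sub, gkMod_cast h2] at hw
      obtain ⟨m, hm, hd⟩ := exists_phiRD_eq (Int.emod_nonneg z hr.ne')
        (Int.emod_lt_of_pos z hr) hw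
      refine ⟨m, by rwa [Set.mem_preimage, hm], ?_⟩
      rw [wmap_wtsG, ZMod.intCast_eq_intCast_iff', hd]
      simp
  saturated := by
    intro m hm n n' hn hn' hmem
    have hle : phiRD r a k m ≤ phiRD r a k (n + m) := by
      rw [add_comm n m]; exact phiRD_le_phiRD_add h2 k m hn
    have hle' : phiRD r a k (n + m) ≤ phiRD r a k (n' + n + m) := by
      rw [add_assoc, add_comm n']; exact phiRD_le_phiRD_add h2 k _ hn'
    have := h'.saturated _ hm (phiRD r a k (n + m) - phiRD r a k m)
      (phiRD r a k (n' + n + m) - phiRD r a k (n + m))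
      (fun i => sub_nonneg.2 (hle i)) (fun i => sub_nonneg.2 (hle' i)) (by simpa using hmem)
    simpa using this
  connected := fun m hm =>
    Relation.ReflTransGen.mono (fun _ _ (h : Linked _ _ _) => h.2) _ _ <|
      reflTransGen_linked_lift h1 h2 (h'.connected _ hm) (phiRD_zero r a k) hm m rfl

theorem IsPrebrick.wtG_spec {s : ℕ} {β : Fin 3 → ℤ} {Γ : Set V3} (h : IsPrebrick s β Γ) (m : V3) :
    wtG s β Γ m ∈ Γ ∧ wmap s β (wtG s β Γ m) = wmap s β m :=
  Classical.epsilon_spec (p := fun g => g ∈ Γ ∧ wmap s β g = wmap s β m)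
    (h.bijOn.surjOn (Set.mem_univ (wmap s β m)))

theorem IsPrebrick.wtG_eq {s : ℕ} {β : Fin 3 → ℤ} {Γ : Set V3} (h : IsPrebrick s β Γ) {g m : V3}
    (hg : g ∈ Γ) (hw : wmap s β g = wmap s β m) : wtG s β Γ m = g :=
  h.bijOn.injOn (h.wtG_spec m).1 hg ((h.wtG_spec m).2.trans hw.symm)

theorem wmap_add (s : ℕ) (β : Fin 3 → ℤ) (m n : V3) :
    wmap s β (m + n) = wmap s β m + wmap s β n := by
  simp [wmap, mul_add, Finset.sum_add_distrib]

theorem IsPrebrick.wtG_add_wtG {s : ℕ} {β : Fin 3 → ℤ} {Γ : Set V3} (h : IsPrebrick s β Γ)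
    (n m : V3) : wtG s β Γ (n + wtG s β Γ m) = wtG s β Γ (n + m) :=
  h.wtG_eq (h.wtG_spec _).1 (by
    rw [(h.wtG_spec _).2, wmap_add, wmap_add, (h.wtG_spec m).2])

/-- A submonoid containing the differences for elementary steps contains `S(Γ)`. -/
theorem IsPrebrick.SG_le {s : ℕ} {β : Fin 3 → ℤ} {Γ : Set V3} (h : IsPrebrick s β Γ)
    {T : AddSubmonoid V3}
    (hT : ∀ i, ∀ m ∈ Γ, ee i + m - wtG s β Γ (ee i + m) ∈ T) : SG s β Γ ≤ T := by
  let N : AddSubmonoid V3 :=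
    { carrier := {n | ∀ m ∈ Γ, n + m - wtG s β Γ (n + m) ∈ T}
      zero_mem' := fun m hm => by
        rw [zero_add, h.wtG_eq hm rfl, sub_self]; exact T.zero_mem
      add_mem' := fun {x y} hx hy m hm => by
        have := T.add_mem (hx _ (h.wtG_spec (y + m)).1) (hy m hm)
        rw [h.wtG_add_wtG, ← add_assoc] at this
        convert this using 1
        abel }
  refine (AddSubmonoid.closure_le (S := T)).2 ?_
  rintro v ⟨n, m, hn, hm, rfl⟩
  have hnN : n ∈ N := by
    have hsum : n = ∑ i, (n i).toNat • ee i := by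
      ext j
      simp [Finset.sum_apply, ee, Pi.single_apply, hn j]
    rw [hsum]
    exact N.sum_mem fun i _ => N.nsmul_mem (hT i) _
  exact hnN m hm

theorem IsPrebrick.dvd_dd_sub_wtG {r a : ℕ} {Γ : Set V3} (h : IsPrebrick r (wtsG r a) Γ) (m : V3) :
    (r : ℤ) ∣ dd r a (m - wtG r (wtsG r a) Γ m) := by
  have := (h.wtG_spec m).2
  rw [wmap_wtsG, wmap_wtsG, ZMod.intCast_eq_intCast_iff_dvd_sub] at this
  rwa [sub_eq_add_neg, dd_add, dd_neg, ← sub_eq_add_neg]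

theorem IsPrebrick.dvd_dd_of_mem_SG {r a : ℕ} {Γ : Set V3} (h : IsPrebrick r (wtsG r a) Γ) {v : V3}
    (hv : v ∈ SG r (wtsG r a) Γ) : (r : ℤ) ∣ dd r a v := by
  induction hv using AddSubmonoid.closure_induction with
  | mem x hx =>
    obtain ⟨n, m, -, -, rfl⟩ := hx
    exact h.dvd_dd_sub_wtG _
  | zero => simp [dd_zero]
  | add x y _ _ hx hy => rw [dd_add]; exact dvd_add hx hy

theorem IsPrebrick.phiRD_sub_wtG {r a : ℕ} (h1 : 0 < a) (h2 : a < r) {k : Fin 3} {Γ' : Set V3}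
    (h' : IsPrebrick (gkMod r a k) (gkWts r a k) Γ') (m : V3) :
    phiRD r a k (m - wtG r (wtsG r a) (phiRD r a k ⁻¹' Γ') m) =
      phiRD r a k m - wtG (gkMod r a k) (gkWts r a k) Γ' (phiRD r a k m) := by
  have h := h'.preimage_phiRD h1 h2
  obtain ⟨hmem, hw⟩ := h.wtG_spec m
  have hadd := phiRD_add_of_dvd k (wtG r (wtsG r a) (phiRD r a k ⁻¹' Γ') m) (h.dvd_dd_sub_wtG m)
  rw [add_sub_cancel] at hadd
  rw [h'.wtG_eq hmem (by rw [wmap_phiRD h2, wmap_phiRD h2, (wmap_wtsG_eq_iff r a _ _).1 hw])]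
  exact eq_sub_of_add_eq' hadd.symm

theorem IsPrebrick.bijOn_phiRD_SG {r a : ℕ} (h1 : 0 < a) (h2 : a < r) {k : Fin 3} {Γ' : Set V3}
    (h' : IsPrebrick (gkMod r a k) (gkWts r a k) Γ') :
    Set.BijOn (phiRD r a k) (SG r (wtsG r a) (phiRD r a k ⁻¹' Γ') : Set V3)
      (SG (gkMod r a k) (gkWts r a k) Γ' : Set V3) := by
  have h := h'.preimage_phiRD h1 h2
  refine ⟨fun v hv => ?_, fun v hv w hw he => ?_, ?_⟩
  · induction hv using AddSubmonoid.closure_induction with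
    | mem x hx =>
      obtain ⟨n, m, hn, hm, rfl⟩ := hx
      refine AddSubmonoid.subset_closure
        ⟨phiRD r a k (n + m) - phiRD r a k m, phiRD r a k m, fun i => ?_, hm, ?_⟩
      · rw [add_comm n m]
        exact sub_nonneg.2 (phiRD_le_phiRD_add h2 k m hn i)
      · rw [sub_add_cancel, h'.phiRD_sub_wtG h1 h2]
    | zero => rw [phiRD_zero]; exact AddSubmonoid.zero_mem _
    | add x y _ hy ihx ihy =>
      rw [phiRD_add_of_dvd k x (h.dvd_dd_of_mem_SG hy)]
      exact add_mem ihx ihy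
  · refine eq_of_phiRD_eq h1 h2 he ?_
    rw [Int.emod_eq_zero_of_dvd (h.dvd_dd_of_mem_SG hv),
      Int.emod_eq_zero_of_dvd (h.dvd_dd_of_mem_SG hw)]
  · let T : AddSubmonoid V3 :=
      { carrier := phiRD r a k '' (SG r (wtsG r a) (phiRD r a k ⁻¹' Γ') : Set V3)
        zero_mem' := ⟨0, AddSubmonoid.zero_mem _, phiRD_zero r a k⟩
        add_mem' := by
          rintro _ _ ⟨x, hx, rfl⟩ ⟨y, hy, rfl⟩
          exact ⟨x + y, add_mem hx hy, phiRD_add_of_dvd k x (h.dvd_dd_of_mem_SG hy)⟩ }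
    refine h'.SG_le (T := T) fun i p hp => ?_
    obtain ⟨m, hm, hmi⟩ := exists_phiRD_add_ee h1 h2 k p i
    refine ⟨ee i + m - wtG r (wtsG r a) (phiRD r a k ⁻¹' Γ') (ee i + m),
      AddSubmonoid.subset_closure ⟨ee i, m, ee_nonneg i, by rwa [Set.mem_preimage, hm], rfl⟩, ?_⟩
    rw [h'.phiRD_sub_wtG h1 h2, add_comm (ee i) m, hmi, add_comm p]

/-- Proposition 4.4: for a `G_k`-prebrick `Γ′` and `Γ = φ_k⁻¹(Γ′)`,
the map `ψ_k : M → ℤ³` (which agrees with `φ_k` on the invariant lattice `M`, dividing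
`d(n)` by `r` in the `k`-th coordinate) maps `S(Γ)` bijectively onto `S(Γ′)`;
in particular if `Γ′` is a `G_k`-brick, then `Γ` is a `G`-brick. -/
theorem psi_bijOn_SG (r a : ℕ) (h1 : 0 < a) (h2 : a < r) (hcop : Nat.Coprime r a)
    (k : Fin 3) (Γ' : Set V3) (h' : IsPrebrick (gkMod r a k) (gkWts r a k) Γ') :
    Set.BijOn (phiRD r a k)
        (SG r (wtsG r a) (phiRD r a k ⁻¹' Γ') : Set V3)
        (SG (gkMod r a k) (gkWts r a k) Γ' : Set V3) ∧
      (IsBrick (gkMod r a k) (gkWts r a k) Γ' → IsBrick r (wtsG r a) (phiRD r a k ⁻¹' Γ')) := by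
  refine ⟨h'.bijOn_phiRD_SG h1 h2, fun hb => ⟨h'.preimage_phiRD h1 h2, fun v hv hnv => ?_⟩⟩
  have h := h'.preimage_phiRD h1 h2
  have hbij := h'.bijOn_phiRD_SG h1 h2
  have hsum := phiRD_add_of_dvd k v (h.dvd_dd_of_mem_SG hnv)
  rw [add_neg_cancel, phiRD_zero] at hsum
  have hneg := hbij.mapsTo hnv
  rw [eq_neg_of_add_eq_zero_right hsum.symm] at hneg
  exact hbij.injOn hv (zero_mem _)
    ((hb.2 _ (hbij.mapsTo hv) hneg).trans (phiRD_zero r a k).symm)
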